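/- arXiv:2412.12944 — 2 statements merged into one kernel-verified Lean document; each statement's English description precedes it below -/
import Mathlib

section
/- Let X and Y be real Hilbert spaces, K : X → Y bounded linear, τ, σ > 0, ρ ≥ 0, L̄ ≥ 0, γ̄ ∈ ℝ (possibly negative), and κ ∈ (0, 1), and suppose max{−2γ̄, 2L̄/(1 − κ)}·τ + τσ‖K‖² ≤ 1. Then 1 + 2τ·min{γ̄, L̄} − τσ‖K‖² ≥ 0, and for every u = (x, y) ∈ X × Y: (a) (1 − κ)⟨Mu, u⟩ ≥ 2L̄‖x‖²; (b) τ(⟨Mu, u⟩ + 2γ̄‖x‖² + 2ρ‖y‖²) ≥ (1 + 2τ·min{γ̄, L̄} − τσ‖K‖²)‖x‖²; (c) τ(⟨Mu, u⟩ + 2L̄‖x‖²) ≥ (1 + 2τ·min{γ̄, L̄} − τσ‖K‖²)‖x‖². In particular M, M + 2·diag(γ̄·Id, ρ·Id) and (1 − κ)M − 2·diag(L̄·Id, 0) are positive semidefinite. -/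
open scoped RealInnerProductSpace

/-- The quadratic form `⟨M u, u⟩` of the primal-dual preconditioning operator
`M(x, y) := (τ⁻¹ x − K* y, σ⁻¹ y − K x)` on the product Hilbert space `X × Y`. -/
noncomputable def Mquad {X Y : Type*} [NormedAddCommGroup X] [InnerProductSpace ℝ X]
    [CompleteSpace X] [NormedAddCommGroup Y] [InnerProductSpace ℝ Y] [CompleteSpace Y]
    (K : X →L[ℝ] Y) (τ σ : ℝ) (u : X × Y) : ℝ :=
  ⟪τ⁻¹ • u.1 - (ContinuousLinearMap.adjoint K) u.2, u.1⟫ +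
    ⟪σ⁻¹ • u.2 - K u.1, u.2⟫

/-- Expansion of the preconditioning quadratic form. -/
lemma Mquad_eq {X Y : Type*} [NormedAddCommGroup X] [InnerProductSpace ℝ X]
    [CompleteSpace X] [NormedAddCommGroup Y] [InnerProductSpace ℝ Y] [CompleteSpace Y]
    (K : X →L[ℝ] Y) (τ σ : ℝ) (u : X × Y) :
    Mquad K τ σ u = τ⁻¹ * ‖u.1‖ ^ 2 - 2 * ⟪K u.1, u.2⟫ + σ⁻¹ * ‖u.2‖ ^ 2 := by
  simp only [Mquad, inner_sub_left, real_inner_smul_left, real_inner_self_eq_norm_sq,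
    ContinuousLinearMap.adjoint_inner_left]
  rw [real_inner_comm (K u.1) u.2]
  ring

/-- Young's inequality bounds the preconditioning quadratic form from below. -/
lemma le_mul_Mquad {X Y : Type*} [NormedAddCommGroup X] [InnerProductSpace ℝ X]
    [CompleteSpace X] [NormedAddCommGroup Y] [InnerProductSpace ℝ Y] [CompleteSpace Y]
    (K : X →L[ℝ] Y) {τ σ : ℝ} (hτ : 0 < τ) (hσ : 0 < σ) (u : X × Y) :
    (1 - τ * σ * ‖K‖ ^ 2) * ‖u.1‖ ^ 2 ≤ τ * Mquad K τ σ u := by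
  have hK : ‖K u.1‖ ^ 2 ≤ ‖K‖ ^ 2 * ‖u.1‖ ^ 2 := by
    rw [← mul_pow]
    gcongr
    exact K.le_opNorm u.1
  have hY : 2 * ⟪K u.1, u.2⟫ ≤ σ * ‖K u.1‖ ^ 2 + σ⁻¹ * ‖u.2‖ ^ 2 := by
    have hsq : 0 ≤ σ⁻¹ * ‖σ • K u.1 - u.2‖ ^ 2 := by positivity
    rw [norm_sub_sq_real, real_inner_smul_left, norm_smul, mul_pow, Real.norm_eq_abs,
      sq_abs] at hsq
    have hexp : σ⁻¹ * (σ ^ 2 * ‖K u.1‖ ^ 2 - 2 * (σ * ⟪K u.1, u.2⟫) + ‖u.2‖ ^ 2) =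
        σ * ‖K u.1‖ ^ 2 - 2 * ⟪K u.1, u.2⟫ + σ⁻¹ * ‖u.2‖ ^ 2 := by
      field_simp
    linarith
  have hσK := mul_le_mul_of_nonneg_left hK hσ.le
  have hbound : (τ⁻¹ - σ * ‖K‖ ^ 2) * ‖u.1‖ ^ 2 ≤ Mquad K τ σ u := by
    rw [Mquad_eq]
    linarith
  calc (1 - τ * σ * ‖K‖ ^ 2) * ‖u.1‖ ^ 2
      = τ * ((τ⁻¹ - σ * ‖K‖ ^ 2) * ‖u.1‖ ^ 2) := by field_simp
    _ ≤ τ * Mquad K τ σ u := mul_le_mul_of_nonneg_left hbound hτ.le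

/-- local step-length conditions imply positivity of the relevant
preconditioning quadratic forms. -/
theorem stmt1
    {X Y : Type*} [NormedAddCommGroup X] [InnerProductSpace ℝ X] [CompleteSpace X]
    [NormedAddCommGroup Y] [InnerProductSpace ℝ Y] [CompleteSpace Y]
    (K : X →L[ℝ] Y) (τ σ ρ Lbar γbar κ : ℝ)
    (hτ : 0 < τ) (hσ : 0 < σ) (hρ : 0 ≤ ρ) (hLbar : 0 ≤ Lbar)
    (hκ : 0 < κ ∧ κ < 1)
    (hstep : max (-2 * γbar) (2 * Lbar / (1 - κ)) * τ + τ * σ * ‖K‖ ^ 2 ≤ 1) :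
    (1 + 2 * τ * min γbar Lbar - τ * σ * ‖K‖ ^ 2 ≥ 0) ∧
    ∀ u : X × Y,
      ((1 - κ) * Mquad K τ σ u ≥ 2 * Lbar * ‖u.1‖ ^ 2) ∧
      (τ * (Mquad K τ σ u + 2 * γbar * ‖u.1‖ ^ 2 + 2 * ρ * ‖u.2‖ ^ 2)
          ≥ (1 + 2 * τ * min γbar Lbar - τ * σ * ‖K‖ ^ 2) * ‖u.1‖ ^ 2) ∧
      (τ * (Mquad K τ σ u + 2 * Lbar * ‖u.1‖ ^ 2)
          ≥ (1 + 2 * τ * min γbar Lbar - τ * σ * ‖K‖ ^ 2) * ‖u.1‖ ^ 2) ∧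
      (0 ≤ Mquad K τ σ u) ∧
      (0 ≤ Mquad K τ σ u + 2 * γbar * ‖u.1‖ ^ 2 + 2 * ρ * ‖u.2‖ ^ 2) ∧
      (0 ≤ (1 - κ) * Mquad K τ σ u - 2 * Lbar * ‖u.1‖ ^ 2) := by
  obtain ⟨-, hκ1⟩ := hκ
  have hκ' : 0 < 1 - κ := sub_pos.mpr hκ1
  have hγ : -2 * γbar * τ + τ * σ * ‖K‖ ^ 2 ≤ 1 :=
    le_trans (by gcongr; exact le_max_left _ _) hstep
  have hL : 2 * Lbar / (1 - κ) * τ + τ * σ * ‖K‖ ^ 2 ≤ 1 :=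
    le_trans (by gcongr; exact le_max_right _ _) hstep
  have hLτ : 0 ≤ 2 * Lbar / (1 - κ) * τ := by positivity
  have hτL : 0 ≤ τ * Lbar := by positivity
  have hmin : 1 + 2 * τ * min γbar Lbar - τ * σ * ‖K‖ ^ 2 ≥ 0 := by
    rcases min_choice γbar Lbar with h | h <;> rw [h] <;> linarith
  refine ⟨hmin, fun u => ?_⟩
  have hM := le_mul_Mquad K hτ hσ u
  have hx : 0 ≤ ‖u.1‖ ^ 2 := by positivity
  have hy : 0 ≤ τ * (2 * ρ * ‖u.2‖ ^ 2) := by positivity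
  have ha : (1 - κ) * Mquad K τ σ u ≥ 2 * Lbar * ‖u.1‖ ^ 2 := by
    have hdiv : 2 * Lbar / (1 - κ) * ‖u.1‖ ^ 2 ≤ Mquad K τ σ u := by
      refine le_of_mul_le_mul_left ?_ hτ
      have := mul_le_mul_of_nonneg_right
        (show 2 * Lbar / (1 - κ) * τ ≤ 1 - τ * σ * ‖K‖ ^ 2 by linarith) hx
      linarith
    calc 2 * Lbar * ‖u.1‖ ^ 2 = (1 - κ) * (2 * Lbar / (1 - κ) * ‖u.1‖ ^ 2) := by field_simp
      _ ≤ (1 - κ) * Mquad K τ σ u := mul_le_mul_of_nonneg_left hdiv hκ'.le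
  have hτx : 0 ≤ 2 * τ * ‖u.1‖ ^ 2 := by positivity
  have hminγ := mul_le_mul_of_nonneg_left (min_le_left γbar Lbar) hτx
  have hminL := mul_le_mul_of_nonneg_left (min_le_right γbar Lbar) hτx
  have hb : τ * (Mquad K τ σ u + 2 * γbar * ‖u.1‖ ^ 2 + 2 * ρ * ‖u.2‖ ^ 2)
      ≥ (1 + 2 * τ * min γbar Lbar - τ * σ * ‖K‖ ^ 2) * ‖u.1‖ ^ 2 := by
    linarith
  refine ⟨ha, hb, by linarith, ?_, ?_, sub_nonneg.mpr ha⟩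
  · exact nonneg_of_mul_nonneg_right (le_trans (by positivity) ha) hκ'
  · exact nonneg_of_mul_nonneg_right ((mul_nonneg hmin hx).trans hb) hτ
end

section
/- For every h ∈ L^∞(Ω, μ) and all x₁, x₂ ∈ 𝒜, the derivatives of the solution map satisfy the Lipschitz estimate ‖w′_{x₁}(h) − w′_{x₂}(h)‖ ≤ 2C₁C₃‖h‖_{L^∞}‖x₂ − x₁‖_{L^∞}. -/
open MeasureTheory
open scoped RealInnerProductSpace

/-- The integral of `x ⟪u, v⟫` is the `L²` inner product of the product `x • u` with `v`. -/
theorem integral_mul_inner_eq_inner_smul {Ω E : Type*} [MeasurableSpace Ω] {μ : Measure Ω}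
    [NormedAddCommGroup E] [InnerProductSpace ℝ E] (x : Lp ℝ ⊤ μ) (u v : Lp E 2 μ) :
    ∫ ω, x ω * ⟪u ω, v ω⟫ ∂μ = ⟪(x • u : Lp E 2 μ), v⟫ := by
  rw [L2.inner_def]
  refine integral_congr_ae ?_
  filter_upwards [Lp.coeFn_lpSMul (r := 2) x u] with ω hω
  rw [hω, Pi.smul_apply', real_inner_smul_left]

theorem Lp_top_smul_sub {Ω E : Type*} [MeasurableSpace Ω] {μ : Measure Ω}
    [NormedAddCommGroup E] [InnerProductSpace ℝ E] (x : Lp ℝ ⊤ μ) (u v : Lp E 2 μ) :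
    (x • (u - v) : Lp E 2 μ) = (x • u : Lp E 2 μ) - (x • v : Lp E 2 μ) := by
  rw [sub_eq_add_neg, sub_eq_add_neg, Lp.add_smul, Lp.smul_neg]

theorem Lp_top_sub_smul {Ω E : Type*} [MeasurableSpace Ω] {μ : Measure Ω}
    [NormedAddCommGroup E] [InnerProductSpace ℝ E] (x y : Lp ℝ ⊤ μ) (u : Lp E 2 μ) :
    ((x - y) • u : Lp E 2 μ) = (x • u : Lp E 2 μ) - (y • u : Lp E 2 μ) := by
  rw [sub_eq_add_neg, sub_eq_add_neg, Lp.smul_add, Lp.neg_smul]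

/-- If `‖e‖ ^ 2 ≤ C * b` (coercivity) and `b ≤ K * ‖e‖` (continuity), then `‖e‖ ≤ C * K`. -/
theorem norm_le_of_sq_le_mul_of_le_mul_norm {H : Type*} [SeminormedAddCommGroup H] {e : H}
    {C K b : ℝ} (hC : 0 ≤ C) (hK : 0 ≤ K) (hcoer : ‖e‖ ^ 2 ≤ C * b) (hb : b ≤ K * ‖e‖) :
    ‖e‖ ≤ C * K := by
  rcases (norm_nonneg e).eq_or_lt with he | he
  · rw [← he]
    positivity
  · refine le_of_mul_le_mul_right ?_ he
    calc ‖e‖ * ‖e‖ = ‖e‖ ^ 2 := (sq _).symm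
      _ ≤ C * b := hcoer
      _ ≤ C * (K * ‖e‖) := by gcongr
      _ = C * K * ‖e‖ := by ring

/-- Lipschitz continuity of the Fréchet derivative of the solution map of
the parametrized variational problem (abstract complete electrode model):
`‖w′_{x₁}(h) − w′_{x₂}(h)‖ ≤ 2C₁C₃‖h‖‖x₂ − x₁‖` with `C₃ = C₁(C₁‖ℓ‖)`. -/
theorem stmt9
    {Ω : Type*} [MeasurableSpace Ω] (μ : Measure Ω) (d : ℕ) (hd : 1 ≤ d)
    {H : Type*} [NormedAddCommGroup H] [InnerProductSpace ℝ H] [CompleteSpace H]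
    (D : H →L[ℝ] Lp (EuclideanSpace ℝ (Fin d)) 2 μ)
    (hD : ∀ w : H, ‖D w‖ ≤ ‖w‖)
    (B₀ : H →L[ℝ] H →L[ℝ] ℝ) (ℓ : H →L[ℝ] ℝ)
    (xm xM C₁ : ℝ) (hxm : 0 < xm) (hxmM : xm < xM) (hC₁ : 0 < C₁)
    (hcoer : ∀ x : Lp ℝ ⊤ μ, (∀ᵐ ω ∂μ, xm / 2 ≤ x ω ∧ x ω ≤ xM + xm / 2) →
      ∀ w : H, ‖w‖ ^ 2 ≤ C₁ * (B₀ w w + ∫ ω, x ω * ⟪(D w) ω, (D w) ω⟫ ∂μ))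
    (W : Lp ℝ ⊤ μ → H)
    (hW : ∀ x : Lp ℝ ⊤ μ, (∀ᵐ ω ∂μ, xm / 2 ≤ x ω ∧ x ω ≤ xM + xm / 2) →
      ∀ w : H, B₀ (W x) w + ∫ ω, x ω * ⟪(D (W x)) ω, (D w) ω⟫ ∂μ = ℓ w)
    -- `W' x h` is the derivative of the solution map at `x` in direction `h`
    (W' : Lp ℝ ⊤ μ → Lp ℝ ⊤ μ → H)
    (hW' : ∀ x : Lp ℝ ⊤ μ, (∀ᵐ ω ∂μ, xm / 2 ≤ x ω ∧ x ω ≤ xM + xm / 2) →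
      ∀ h : Lp ℝ ⊤ μ, ∀ w : H,
        B₀ (W' x h) w + ∫ ω, x ω * ⟪(D (W' x h)) ω, (D w) ω⟫ ∂μ
          = -∫ ω, h ω * ⟪(D (W x)) ω, (D w) ω⟫ ∂μ)
    (h : Lp ℝ ⊤ μ) (x₁ x₂ : Lp ℝ ⊤ μ)
    (hx₁ : ∀ᵐ ω ∂μ, xm ≤ x₁ ω ∧ x₁ ω ≤ xM)
    (hx₂ : ∀ᵐ ω ∂μ, xm ≤ x₂ ω ∧ x₂ ω ≤ xM) :
    ‖W' x₁ h - W' x₂ h‖ ≤ 2 * C₁ * (C₁ * (C₁ * ‖ℓ‖)) * ‖h‖ * ‖x₂ - x₁‖ := by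
  have hmem : ∀ x : Lp ℝ ⊤ μ, (∀ᵐ ω ∂μ, xm ≤ x ω ∧ x ω ≤ xM) →
      ∀ᵐ ω ∂μ, xm / 2 ≤ x ω ∧ x ω ≤ xM + xm / 2 := fun x hx ↦ by
    filter_upwards [hx] with ω hω
    constructor <;> linarith [hω.1, hω.2]
  replace hx₁ := hmem x₁ hx₁
  replace hx₂ := hmem x₂ hx₂
  simp only [integral_mul_inner_eq_inner_smul] at hcoer hW hW'
  have hbound : ∀ (x : Lp ℝ ⊤ μ) (u v : H),
      |⟪(x • D u : Lp (EuclideanSpace ℝ (Fin d)) 2 μ), D v⟫| ≤ ‖x‖ * ‖u‖ * ‖v‖ := fun x u v ↦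
    calc _ ≤ ‖(x • D u : Lp (EuclideanSpace ℝ (Fin d)) 2 μ)‖ * ‖D v‖ := abs_real_inner_le_norm _ _
      _ ≤ ‖x‖ * ‖D u‖ * ‖D v‖ := by gcongr; exact Lp.norm_smul_le _ _
      _ ≤ ‖x‖ * ‖u‖ * ‖v‖ := by gcongr <;> exact hD _
  have hB_sub : ∀ u₁ u₂ w : H,
      B₀ (u₁ - u₂) w + ⟪(x₁ • D (u₁ - u₂) : Lp (EuclideanSpace ℝ (Fin d)) 2 μ), D w⟫ =
        (B₀ u₁ w + ⟪(x₁ • D u₁ : Lp (EuclideanSpace ℝ (Fin d)) 2 μ), D w⟫) -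
        (B₀ u₂ w + ⟪(x₂ • D u₂ : Lp (EuclideanSpace ℝ (Fin d)) 2 μ), D w⟫) +
        ⟪((x₂ - x₁) • D u₂ : Lp (EuclideanSpace ℝ (Fin d)) 2 μ), D w⟫ := fun u₁ u₂ w ↦ by
    simp only [map_sub, sub_apply, Lp_top_smul_sub, Lp_top_sub_smul, inner_sub_left]
    ring
  have hW_norm : ‖W x₂‖ ≤ C₁ * ‖ℓ‖ := by
    refine norm_le_of_sq_le_mul_of_le_mul_norm hC₁.le (norm_nonneg _) (hcoer x₂ hx₂ _) ?_
    rw [hW x₂ hx₂]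
    exact (le_abs_self _).trans (ℓ.le_opNorm _)
  have hW'_norm : ‖W' x₂ h‖ ≤ C₁ * (‖h‖ * ‖W x₂‖) := by
    refine norm_le_of_sq_le_mul_of_le_mul_norm hC₁.le (by positivity) (hcoer x₂ hx₂ _) ?_
    rw [hW' x₂ hx₂]
    exact (neg_le_abs _).trans (hbound _ _ _)
  have hW_sub : ‖W x₁ - W x₂‖ ≤ C₁ * (‖x₂ - x₁‖ * ‖W x₂‖) := by
    refine norm_le_of_sq_le_mul_of_le_mul_norm hC₁.le (by positivity) (hcoer x₁ hx₁ _) ?_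
    refine le_trans (le_of_eq ?_) ((le_abs_self _).trans (hbound (x₂ - x₁) (W x₂) (W x₁ - W x₂)))
    have h₁ := hW x₁ hx₁ (W x₁ - W x₂)
    have h₂ := hW x₂ hx₂ (W x₁ - W x₂)
    rw [hB_sub]
    linarith
  have hW'_sub : ‖W' x₁ h - W' x₂ h‖ ≤
      C₁ * (‖h‖ * ‖W x₁ - W x₂‖ + ‖x₂ - x₁‖ * ‖W' x₂ h‖) := by
    refine norm_le_of_sq_le_mul_of_le_mul_norm hC₁.le (by positivity) (hcoer x₁ hx₁ _) ?_
    have h₁ := hW' x₁ hx₁ h (W' x₁ h - W' x₂ h)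
    have h₂ := hW' x₂ hx₂ h (W' x₁ h - W' x₂ h)
    have hb₁ := (neg_le_abs _).trans (hbound h (W x₁ - W x₂) (W' x₁ h - W' x₂ h))
    have hb₂ := (le_abs_self _).trans (hbound (x₂ - x₁) (W' x₂ h) (W' x₁ h - W' x₂ h))
    rw [map_sub D (W x₁), Lp_top_smul_sub, inner_sub_left] at hb₁
    rw [hB_sub]
    linarith
  calc _ ≤ C₁ * (‖h‖ * ‖W x₁ - W x₂‖ + ‖x₂ - x₁‖ * ‖W' x₂ h‖) := hW'_sub
    _ ≤ C₁ * (‖h‖ * (C₁ * (‖x₂ - x₁‖ * (C₁ * ‖ℓ‖))) +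
          ‖x₂ - x₁‖ * (C₁ * (‖h‖ * (C₁ * ‖ℓ‖)))) := by
      gcongr
      · exact hW_sub.trans (by gcongr)
      · exact hW'_norm.trans (by gcongr)
    _ = _ := by ring
end
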